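/- Let m be a positive integer and n an integer with 0 ≤ n < 2m. Set g^{[m]}_{n,m}(τ) := (∑_{j,p∈ℤ, 0<p≤j} − ∑_{j,p∈ℤ, j<p≤0}) (−1)^j q^{(m+1/2)(j+m−1/2)² − m(p+m−n/(2m))²}. Then θ^{(−)}_{m+1/2, m+1/2}(τ, 0) = 0, and for every τ in the upper half-plane and every z ∈ ℂ with m·z ∉ ℤ + ℤτ: g^{[m]}_{n,m}(τ) · θ_{n,m}(τ, z) = −((−1)^m/(2m)) η(τ)³ ∑_{ℓ=0}^{2m−1} e^{πinℓ/m} · θ^{(−)}_{m+1/2, m+1/2}(τ, z − ℓ/m) / θ^{(−)}_{1/2, 1/2}(τ, z − ℓ/m). -/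

import Mathlib

noncomputable section

open Complex

/-- `e2 w = exp (2 π i w)`; with `q = e^{2πiτ}`, the power `q^x` corresponds to `e2 (x * τ)`. -/
def e2 (w : ℂ) : ℂ := Complex.exp (2 * (Real.pi : ℂ) * Complex.I * w)

/-- Jacobi-type theta function `θ^{(ε)}_{n,m}(τ, z) = ∑_{j∈ℤ} ε^j q^{m(j+n/(2m))²} e^{2πim(j+n/(2m))z}`. -/
def jtheta (ε n m τ z : ℂ) : ℂ :=
  ∑' j : ℤ, ε ^ j *
    e2 (m * ((j : ℂ) + n / (2 * m)) ^ 2 * τ + m * ((j : ℂ) + n / (2 * m)) * z)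

/-- Mock theta function `Φ₁^{(ε)[m,s]}(τ, z₁, z₂)`. -/
def Phi1 (ε m s τ z₁ z₂ : ℂ) : ℂ :=
  ∑' j : ℤ, ε ^ j *
    e2 (m * (j : ℂ) * (z₁ + z₂) + s * z₁ + (m * (j : ℂ) ^ 2 + s * (j : ℂ)) * τ) /
      (1 - e2 (z₁ + (j : ℂ) * τ))

/-- Dedekind eta function `η(τ) = q^{1/24} ∏_{k≥1} (1 - q^k)`. -/
def dedekindEta (τ : ℂ) : ℂ := e2 (τ / 24) * ∏' k : ℕ, (1 - e2 (((k : ℂ) + 1) * τ))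

/-- Jacobi theta `ϑ₁₁(τ, z) = i ∑_{j∈ℤ} (−1)^j q^{(j+1/2)²/2} e^{2πi(j+1/2)z}`. -/
def theta11 (τ z : ℂ) : ℂ :=
  Complex.I * ∑' j : ℤ, (-1 : ℂ) ^ j *
    e2 (((j : ℂ) + 1 / 2) ^ 2 / 2 * τ + ((j : ℂ) + 1 / 2) * z)

/-- Indefinite double sum `(∑_{j,p∈ℤ, 0<p≤j} − ∑_{j,p∈ℤ, j<p≤0}) f j p`. -/
def indefSum (f : ℤ → ℤ → ℂ) : ℂ :=
  ∑' jp : ℤ × ℤ,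
    ((if 0 < jp.2 ∧ jp.2 ≤ jp.1 then f jp.1 jp.2 else 0) -
      (if jp.1 < jp.2 ∧ jp.2 ≤ 0 then f jp.1 jp.2 else 0))

/-- `g^{[m]}_{n,ν}(τ)`. -/
def gfun (m : ℂ) (n ν : ℤ) (τ : ℂ) : ℂ :=
  indefSum fun j p =>
    (-1 : ℂ) ^ j *
      e2 (((m + 1 / 2) * ((j : ℂ) + (ν : ℂ) - ((ν : ℂ) + 1 / 2) / (2 * m + 1)) ^ 2 -
        m * ((p : ℂ) + (ν : ℂ) - (n : ℂ) / (2 * m)) ^ 2) * τ)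

/-- `h^{[m]}_{n,ν}(τ, z)`. -/
def hfun (m : ℂ) (n ν : ℤ) (τ z : ℂ) : ℂ :=
  ∑' j : ℤ,
    e2 (m * (j : ℂ) * z + (n : ℂ) * z / 2 +
        (m * (j : ℂ) ^ 2 + (n : ℂ) * ((j : ℂ) + (ν : ℂ))) * τ) /
      (1 - e2 (m * z + 2 * m * ((j : ℂ) + (ν : ℂ)) * τ))

/-- `G^{[m]}_{n,ν}(τ, z)`. -/
def Gfun (m : ℂ) (n ν : ℤ) (τ z : ℂ) : ℂ :=
  gfun m n ν τ * jtheta 1 (n : ℂ) m τ z +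
    (-1 : ℂ) ^ ν * e2 (-(m * (ν : ℂ) ^ 2) * τ) *
      jtheta (-1) ((ν : ℂ) + 1 / 2) (m + 1 / 2) τ 0 * hfun m n ν τ z

/-- `F^{[m](a,b)}_{n,ν}(τ, z)`. -/
def Ffun (m : ℂ) (a b n ν : ℤ) (τ z : ℂ) : ℂ :=
  e2 ((a : ℂ) * z / 2 + (a : ℂ) ^ 2 / (4 * m) * τ) *
    Gfun m n ν τ (z + (a : ℂ) * τ / m + (b : ℂ) / m)

/-- The coefficient `f_{j,k}` of Lemma 3.1:
`f_{j,k} = (−1)^j q^{(m+1/2)(j+s/(2m+1))² − k²/(4m)} e^{−2πijm(z₁−z₂)+πik(z₁−z₂)}`. -/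
def fcoef (m s τ z₁ z₂ : ℂ) (j k : ℤ) : ℂ :=
  (-1 : ℂ) ^ j *
    e2 (((m + 1 / 2) * ((j : ℂ) + s / (2 * m + 1)) ^ 2 - (k : ℂ) ^ 2 / (4 * m)) * τ +
      (-((j : ℂ) * m) + (k : ℂ) / 2) * (z₁ - z₂))

/-! ### Basic facts on `e2` -/

lemma e2_add (a b : ℂ) : e2 (a + b) = e2 a * e2 b := by
  simp only [e2, mul_add, Complex.exp_add]

lemma e2_zero : e2 0 = 1 := by simp [e2]

lemma e2_ne_zero (a : ℂ) : e2 a ≠ 0 := Complex.exp_ne_zero _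

lemma e2_int (n : ℤ) : e2 n = 1 := by
  rw [e2, Complex.exp_eq_one_iff]
  exact ⟨n, by ring⟩

lemma e2_congr (n : ℤ) {a b : ℂ} (h : a = b + n) : e2 a = e2 b := by
  rw [h, e2_add, e2_int, mul_one]

lemma e2_half : e2 (1 / 2) = -1 := by
  rw [e2, show 2 * (Real.pi : ℂ) * Complex.I * (1 / 2) = Real.pi * Complex.I by ring,
    Complex.exp_pi_mul_I]

lemma e2_congr_neg (n : ℤ) {a b : ℂ} (h : a = b + n + 1 / 2) : e2 a = -e2 b := by
  rw [h, e2_add, e2_half, e2_congr n rfl]; ring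

lemma e2_zpow (n : ℤ) (w : ℂ) : e2 (n * w) = e2 w ^ n := by
  rw [e2, e2, ← Complex.exp_int_mul]; congr 1; ring

lemma e2_pow (n : ℕ) (w : ℂ) : e2 (n * w) = e2 w ^ n := by
  rw [e2, e2, ← Complex.exp_nat_mul]; congr 1; ring

lemma neg_one_zpow_e2 (n : ℤ) : (-1 : ℂ) ^ n = e2 (n / 2) := by
  rw [← e2_half, ← e2_zpow]; congr 1; ring

lemma norm_e2 (w : ℂ) : ‖e2 w‖ = Real.exp (-(2 * Real.pi * w.im)) := by
  rw [e2, Complex.norm_exp]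
  congr 1
  simp [Complex.mul_re]

lemma e2_eq_one_iff (w : ℂ) : e2 w = 1 ↔ ∃ n : ℤ, w = n := by
  rw [e2, Complex.exp_eq_one_iff]
  constructor
  · rintro ⟨n, hn⟩
    refine ⟨n, ?_⟩
    have h2 : (2 * (Real.pi : ℂ) * Complex.I) ≠ 0 := by
      simp [Real.pi_ne_zero]
    apply mul_left_cancel₀ h2
    rw [hn]; ring
  · rintro ⟨n, rfl⟩
    exact ⟨n, by ring⟩

lemma summable_e2_quad (a b c : ℂ) (ha : 0 < a.im) :
    Summable (fun j : ℤ => e2 (a * (j : ℂ) ^ 2 + b * j + c)) := by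
  have h := ((summable_jacobiTheta₂_term_iff b (2 * a)).2 (by simpa using ha)).mul_left (e2 c)
  refine h.congr fun j => ?_
  rw [jacobiTheta₂_term, e2, e2, ← Complex.exp_add]
  congr 1
  ring

lemma tsum_e2_quad (a b c : ℂ) :
    ∑' j : ℤ, e2 (a * (j : ℂ) ^ 2 + b * j + c) = e2 c * jacobiTheta₂ b (2 * a) := by
  rw [jacobiTheta₂, ← tsum_mul_left]
  refine tsum_congr fun j => ?_
  rw [jacobiTheta₂_term, e2, e2, ← Complex.exp_add]
  congr 1
  ring

lemma summable_mul_e2_quad (a b c : ℂ) (ha : 0 < a.im) :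
    Summable (fun j : ℤ => (j : ℂ) * e2 (a * (j : ℂ) ^ 2 + b * j + c)) := by
  have h := ((summable_jacobiTheta₂'_term_iff b (2 * a)).2 (by simpa using ha)).mul_left
    (e2 c * (2 * (Real.pi : ℂ) * Complex.I)⁻¹)
  refine h.congr fun j => ?_
  have h2 : (2 * (Real.pi : ℂ) * Complex.I) ≠ 0 := by
    simp [Real.pi_ne_zero]
  have h3 : e2 (a * (j : ℂ) ^ 2 + b * j + c) = e2 c * jacobiTheta₂_term j b (2 * a) := by
    rw [jacobiTheta₂_term, e2, e2, ← Complex.exp_add]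
    congr 1
    ring
  rw [h3, jacobiTheta₂'_term]
  field_simp

lemma hasSum_zero_of_antisymm (f : ℤ → ℂ) (hf : Summable f) (c : ℤ) (h : ∀ j, f (c - j) = -f j) :
    HasSum f 0 := by
  have h1 : ∑' j, f (c - j) = ∑' j, f j := (Equiv.subLeft c).tsum_eq f
  simp only [h, tsum_neg] at h1
  have h2 : ∑' j, f j = 0 := by linear_combination (-1 / 2 : ℂ) * h1
  rw [← h2]
  exact hf.hasSum

/-! ### Gauss binomials and the Jacobi triple product -/

/-- Gaussian binomial coefficients. -/
def gb (q : ℂ) : ℕ → ℕ → ℂ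
  | _, 0 => 1
  | 0, _ + 1 => 0
  | n + 1, k + 1 => gb q n k + q ^ (k + 1) * gb q n (k + 1)

/-- The finite products `∏_{k<n} (1 - q^{k+1})`. -/
def qp (q : ℂ) (n : ℕ) : ℂ := ∏ k ∈ Finset.range n, (1 - q ^ (k + 1))

lemma gb_zero (q : ℂ) (n : ℕ) : gb q n 0 = 1 := by cases n <;> rfl

lemma gb_lt (q : ℂ) (n k : ℕ) (h : n < k) : gb q n k = 0 := by
  induction n generalizing k with
  | zero => obtain ⟨k, rfl⟩ := Nat.exists_eq_succ_of_ne_zero (by omega : k ≠ 0); rfl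
  | succ n ih =>
    obtain ⟨k, rfl⟩ := Nat.exists_eq_succ_of_ne_zero (by omega : k ≠ 0)
    rw [Nat.succ_eq_add_one, gb, ih _ (by omega), ih _ (by omega)]; ring

lemma qp_succ (q : ℂ) (n : ℕ) : qp q (n + 1) = qp q n * (1 - q ^ (n + 1)) := by
  rw [qp, Finset.prod_range_succ, qp]

lemma gb_mul (q : ℂ) (n : ℕ) : ∀ i j, i + j = n → gb q n i * qp q i * qp q j = qp q n := by
  induction n with
  | zero =>
    intro i j h
    obtain ⟨rfl, rfl⟩ : i = 0 ∧ j = 0 := by omega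
    simp [gb, qp]
  | succ n ih =>
    intro i j h
    rcases i with _ | i
    · obtain rfl : j = n + 1 := by omega
      simp [gb, qp]
    rw [gb]
    rcases j with _ | j
    · obtain rfl : i = n := by omega
      rw [gb_lt q i (i + 1) (by omega)]
      have := ih i 0 (by omega)
      simp only [qp_succ] at *
      linear_combination (1 - q ^ (i + 1)) * this
    · have h1 := ih i (j + 1) (by omega)
      have h2 := ih (i + 1) j (by omega)
      obtain rfl : n = i + j + 1 := by omega
      simp only [qp_succ] at *
      have e : q ^ (i + j + 1 + 1) = q ^ (i + 1) * q ^ (j + 1) := by rw [← pow_add]; congr 1; ring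
      rw [e]
      linear_combination (1 - q ^ (i + 1)) * h1 + q ^ (i + 1) * (1 - q ^ (j + 1)) * h2

lemma gauss_binom (q y : ℂ) (n : ℕ) :
    ∏ k ∈ Finset.range n, (1 + y * q ^ k) =
      ∑ i ∈ Finset.range (n + 1), q ^ (i.choose 2) * gb q n i * y ^ i := by
  induction n generalizing y with
  | zero => simp [gb]
  | succ n ih =>
    have h1 : ∏ k ∈ Finset.range n, (1 + y * q ^ (k + 1)) =
        ∑ i ∈ Finset.range (n + 1), q ^ (i.choose 2) * gb q n i * (y * q) ^ i := by
      rw [← ih]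
      refine Finset.prod_congr rfl fun k _ => ?_
      ring
    rw [Finset.prod_range_succ', h1]
    rw [Finset.sum_range_succ' _ (n + 1)]
    have h2 : ∀ i, q ^ ((i + 1).choose 2) * gb q (n + 1) (i + 1) * y ^ (i + 1) =
        y * (q ^ (i.choose 2) * gb q n i * (y * q) ^ i) +
          q ^ ((i + 1).choose 2) * gb q n (i + 1) * (y * q) ^ (i + 1) := by
      intro i
      rw [gb, show (i + 1).choose 2 = i + i.choose 2 by simp [Nat.choose_succ_succ]]
      ring
    simp only [h2, Finset.sum_add_distrib, ← Finset.mul_sum]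
    have h3 := Finset.sum_range_succ' (fun i => q ^ (i.choose 2) * gb q n i * (y * q) ^ i) (n + 1)
    rw [Finset.sum_range_succ] at h3
    rw [gb_lt q n (n + 1) (by omega)] at h3
    simp only [gb_zero] at *
    simp at h3 ⊢
    linear_combination h3

lemma finite_prod_shift (τ v : ℂ) (N : ℕ) :
    ∏ k ∈ Finset.range (2 * N + 1), (1 - e2 (v + ((k : ℂ) - N) * τ)) =
      e2 ((N : ℂ) / 2 + N * v - N * (N + 1) / 2 * τ) * ((1 - e2 v) *
        ∏ k ∈ Finset.range N, ((1 - e2 (v + ((k : ℂ) + 1) * τ)) *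
          (1 - e2 (-v + ((k : ℂ) + 1) * τ)))) := by
  induction N with
  | zero => simp [e2_zero]
  | succ N ih =>
    rw [show 2 * (N + 1) + 1 = (2 * N + 1) + 1 + 1 by ring, Finset.prod_range_succ,
      Finset.prod_range_succ', Finset.prod_range_succ _ N]
    have h1 : ∏ k ∈ Finset.range (2 * N + 1),
        (1 - e2 (v + (((k + 1 : ℕ) : ℂ) - (N + 1 : ℕ)) * τ)) =
        ∏ k ∈ Finset.range (2 * N + 1), (1 - e2 (v + ((k : ℂ) - N) * τ)) := by
      refine Finset.prod_congr rfl fun k _ => ?_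
      congr 3; push_cast; ring
    rw [h1, ih]
    have h2 : e2 (((N + 1 : ℕ) : ℂ) / 2 + (N + 1 : ℕ) * v - (N + 1 : ℕ) * ((N + 1 : ℕ) + 1) / 2 * τ) =
        e2 ((N : ℂ) / 2 + N * v - N * (N + 1) / 2 * τ) * (- e2 (v - (N + 1) * τ)) := by
      rw [mul_neg, ← e2_add]
      apply e2_congr_neg 0
      push_cast; ring
    have h3 : e2 (v - (N + 1) * τ) * e2 (-v + ((N : ℂ) + 1) * τ) = 1 := by
      rw [← e2_add, ← e2_zero]; congr 1; ring
    have h4 : e2 (v + (((0 : ℕ) : ℂ) - (N + 1 : ℕ)) * τ) = e2 (v - (N + 1) * τ) := by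
      congr 1; push_cast; ring
    have h5 : e2 (v + (((2 * N + 1 + 1 : ℕ) : ℂ) - (N + 1 : ℕ)) * τ) = e2 (v + ((N : ℂ) + 1) * τ) := by
      congr 1; push_cast; ring
    rw [h2, h4, h5]
    linear_combination (-(e2 ((N : ℂ) / 2 + N * v - N * (N + 1) / 2 * τ) * ((1 - e2 v) *
        ∏ k ∈ Finset.range N, ((1 - e2 (v + ((k : ℂ) + 1) * τ)) *
          (1 - e2 (-v + ((k : ℂ) + 1) * τ))))) * (1 - e2 (v + ((N : ℂ) + 1) * τ))) * h3

lemma finite_jtp (τ v : ℂ) (N : ℕ) :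
    (1 - e2 v) * ∏ k ∈ Finset.range N, ((1 - e2 (v + ((k : ℂ) + 1) * τ)) *
          (1 - e2 (-v + ((k : ℂ) + 1) * τ))) =
      ∑ i ∈ Finset.range (2 * N + 2),
        e2 ((((i : ℤ) - N : ℤ) : ℂ) / 2 + (((i : ℤ) - N : ℤ) : ℂ) * ((((i : ℤ) - N : ℤ) : ℂ) - 1) / 2 * τ
          + (((i : ℤ) - N : ℤ) : ℂ) * v) * gb (e2 τ) (2 * N + 1) i := by
  apply mul_left_cancel₀ (e2_ne_zero ((N : ℂ) / 2 + N * v - N * (N + 1) / 2 * τ))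
  rw [← finite_prod_shift]
  have h := gauss_binom (e2 τ) (e2 (1 / 2 + v - N * τ)) (2 * N + 1)
  have h1 : ∏ k ∈ Finset.range (2 * N + 1), (1 - e2 (v + ((k : ℂ) - N) * τ)) =
      ∏ k ∈ Finset.range (2 * N + 1), (1 + e2 (1 / 2 + v - N * τ) * e2 τ ^ k) := by
    refine Finset.prod_congr rfl fun k _ => ?_
    rw [← e2_pow, ← e2_add, sub_eq_add_neg]
    congr 1
    symm
    apply e2_congr_neg 0
    push_cast; ring
  rw [h1, h, Finset.mul_sum]
  refine Finset.sum_congr rfl fun i _ => ?_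
  rw [← e2_pow, ← e2_pow, ← mul_assoc, ← e2_add, mul_right_comm, ← e2_add]
  congr 1
  rw [Nat.cast_choose_two ℂ]
  congr 1
  push_cast; ring
lemma norm_e2_lt_one {τ : ℂ} (hτ : 0 < τ.im) : ‖e2 τ‖ < 1 := by
  rw [norm_e2, Real.exp_lt_one_iff]
  have := Real.pi_pos
  have : 0 < 2 * Real.pi * τ.im := by positivity
  linarith

/-- The infinite product `∏_{k≥1} (1 - q^k)`. -/
def Pinf (τ : ℂ) : ℂ := ∏' k : ℕ, (1 - e2 (((k : ℂ) + 1) * τ))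

lemma summable_shift (τ v : ℂ) (hτ : 0 < τ.im) :
    Summable (fun k : ℕ => ‖-e2 (v + ((k : ℂ) + 1) * τ)‖) := by
  have h : Summable (fun k : ℕ => ‖e2 (v + τ)‖ * ‖e2 τ‖ ^ k) :=
    (summable_geometric_of_lt_one (norm_nonneg _) (norm_e2_lt_one hτ)).mul_left _
  refine h.congr fun k => ?_
  rw [← norm_pow, ← e2_pow, ← norm_mul, ← e2_add, norm_neg]
  congr 2; ring

lemma tendsto_shift (τ v : ℂ) (hτ : 0 < τ.im) :
    Filter.Tendsto (fun N : ℕ => ∏ k ∈ Finset.range N, (1 - e2 (v + ((k : ℂ) + 1) * τ)))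
      Filter.atTop (nhds (∏' k : ℕ, (1 - e2 (v + ((k : ℂ) + 1) * τ)))) := by
  have := (multipliable_one_add_of_summable (summable_shift τ v hτ)).hasProd.tendsto_prod_nat
  simpa [← sub_eq_add_neg] using this

lemma tprod_shift_ne_zero (τ v : ℂ) (hτ : 0 < τ.im) (h : ∀ k : ℕ, e2 (v + ((k : ℂ) + 1) * τ) ≠ 1) :
    ∏' k : ℕ, (1 - e2 (v + ((k : ℂ) + 1) * τ)) ≠ 0 := by
  have := tprod_one_add_ne_zero_of_summable (f := fun k : ℕ => -e2 (v + ((k : ℂ) + 1) * τ))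
    (fun k => by
      rw [← sub_eq_add_neg]
      exact sub_ne_zero.2 (h k).symm) (summable_shift τ v hτ)
  simpa [← sub_eq_add_neg] using this

lemma e2_succ_ne_one {τ : ℂ} (hτ : 0 < τ.im) (k : ℕ) : e2 (((k : ℂ) + 1) * τ) ≠ 1 := by
  intro h
  have h1 : 0 < ((((k : ℂ) + 1) * τ)).im := by
    simp only [mul_im, add_re, natCast_re, one_re, add_im, natCast_im, one_im]
    have : (0 : ℝ) < (k : ℝ) + 1 := by positivity
    have := mul_pos this hτ
    linarith
  have h2 := norm_e2_lt_one h1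
  rw [h] at h2
  simp at h2

lemma Pinf_ne_zero {τ : ℂ} (hτ : 0 < τ.im) : Pinf τ ≠ 0 := by
  have := tprod_shift_ne_zero τ 0 hτ (fun k => by simpa using e2_succ_ne_one hτ k)
  simpa [Pinf] using this

lemma qp_eq (τ : ℂ) (n : ℕ) :
    qp (e2 τ) n = ∏ k ∈ Finset.range n, (1 - e2 (((k : ℂ) + 1) * τ)) := by
  rw [qp]
  refine Finset.prod_congr rfl fun k _ => ?_
  rw [← e2_pow]; push_cast; rfl

lemma tendsto_qp {τ : ℂ} (hτ : 0 < τ.im) :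
    Filter.Tendsto (qp (e2 τ)) Filter.atTop (nhds (Pinf τ)) := by
  have := tendsto_shift τ 0 hτ
  simp only [zero_add] at this
  exact this.congr fun n => (qp_eq τ n).symm

lemma qp_ne_zero {τ : ℂ} (hτ : 0 < τ.im) (n : ℕ) : qp (e2 τ) n ≠ 0 := by
  rw [qp_eq, Finset.prod_ne_zero_iff]
  intro k _
  exact sub_ne_zero.2 (e2_succ_ne_one hτ k).symm

lemma gb_eq {τ : ℂ} (hτ : 0 < τ.im) (i j : ℕ) :
    gb (e2 τ) (i + j) i = qp (e2 τ) (i + j) * (qp (e2 τ) i)⁻¹ * (qp (e2 τ) j)⁻¹ := by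
  have h1 := qp_ne_zero hτ i
  have h2 := qp_ne_zero hτ j
  have := gb_mul (e2 τ) (i + j) i j rfl
  field_simp
  linear_combination this

lemma gb_bound {τ : ℂ} (hτ : 0 < τ.im) : ∃ C : ℝ, 0 ≤ C ∧ ∀ n i : ℕ, ‖gb (e2 τ) n i‖ ≤ C := by
  obtain ⟨C1, hC1⟩ := (tendsto_qp hτ).norm.bddAbove_range
  obtain ⟨C2, hC2⟩ := ((tendsto_qp hτ).inv₀ (Pinf_ne_zero hτ)).norm.bddAbove_range
  have h1 : ∀ n, ‖qp (e2 τ) n‖ ≤ C1 := fun n => hC1 ⟨n, rfl⟩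
  have h2 : ∀ n, ‖(qp (e2 τ) n)⁻¹‖ ≤ C2 := fun n => hC2 ⟨n, rfl⟩
  have h10 := (norm_nonneg _).trans (h1 0)
  have h20 := (norm_nonneg _).trans (h2 0)
  refine ⟨C1 * C2 * C2, by positivity, fun n i => ?_⟩
  rcases lt_or_ge n i with h | h
  · rw [gb_lt _ _ _ h]; simp; positivity
  · obtain ⟨j, rfl⟩ := Nat.exists_eq_add_of_le h
    rw [gb_eq hτ, norm_mul, norm_mul]
    gcongr
    · exact h1 _
    · exact h2 _
    · exact h2 _

lemma tendsto_gb {τ : ℂ} (hτ : 0 < τ.im) (t : ℤ) :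
    Filter.Tendsto (fun N : ℕ => gb (e2 τ) (2 * N + 1) (t + N).toNat) Filter.atTop
      (nhds (Pinf τ)⁻¹) := by
  have hP := Pinf_ne_zero hτ
  have hq := tendsto_qp hτ
  have a1 : Filter.Tendsto (fun N : ℕ => 2 * N + 1) Filter.atTop Filter.atTop :=
    Filter.tendsto_atTop_mono (fun N => by simp only [id]; omega) Filter.tendsto_id
  have a2 : Filter.Tendsto (fun N : ℕ => (t + N).toNat) Filter.atTop Filter.atTop := by
    refine Filter.tendsto_atTop.2 fun b => ?_
    filter_upwards [Filter.eventually_ge_atTop (b + t.natAbs)] with N hN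
    omega
  have a3 : Filter.Tendsto (fun N : ℕ => (N + 1 - t).toNat) Filter.atTop Filter.atTop := by
    refine Filter.tendsto_atTop.2 fun b => ?_
    filter_upwards [Filter.eventually_ge_atTop (b + t.natAbs)] with N hN
    omega
  have h := ((hq.comp a1).mul ((hq.comp a2).inv₀ hP)).mul ((hq.comp a3).inv₀ hP)
  rw [mul_inv_cancel₀ hP, one_mul] at h
  refine h.congr' ?_
  filter_upwards [Filter.eventually_ge_atTop (1 + t.natAbs)] with N hN
  have e : 2 * N + 1 = (t + N).toNat + (N + 1 - t).toNat := by omega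
  simp only [Function.comp]
  rw [e, gb_eq hτ]

lemma tannery {τ : ℂ} (hτ : 0 < τ.im) (c : ℤ → ℂ) (hc : Summable c) :
    Filter.Tendsto (fun N : ℕ => ∑ i ∈ Finset.range (2 * N + 2),
      c ((i : ℤ) - N) * gb (e2 τ) (2 * N + 1) i) Filter.atTop
      (nhds ((∑' t, c t) * (Pinf τ)⁻¹)) := by
  obtain ⟨C, hC0, hC⟩ := gb_bound hτ
  rw [← tsum_mul_right]
  have key : ∀ N : ℕ, ∑ i ∈ Finset.range (2 * N + 2), c ((i : ℤ) - N) * gb (e2 τ) (2 * N + 1) i =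
      ∑' t : ℤ, if -(N : ℤ) ≤ t then c t * gb (e2 τ) (2 * N + 1) (t + N).toNat else 0 := by
    intro N
    rw [tsum_eq_sum (s := (Finset.range (2 * N + 2)).image (fun i : ℕ => (i : ℤ) - N))]
    · rw [Finset.sum_image (by intro a _ b _ h; simpa using h)]
      refine Finset.sum_congr rfl fun i _ => ?_
      rw [if_pos (by omega)]
      congr 2
      omega
    · intro t ht
      split_ifs with h
      · rw [gb_lt, mul_zero]
        by_contra hh
        apply ht
        rw [Finset.mem_image]
        exact ⟨(t + N).toNat, by rw [Finset.mem_range]; omega, by omega⟩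
      · rfl
  simp only [key]
  refine tendsto_tsum_of_dominated_convergence (bound := fun t => ‖c t‖ * C) (hc.norm.mul_right C)
    ?_ ?_
  · intro t
    refine ((tendsto_gb hτ t).const_mul (c t)).congr' ?_
    filter_upwards [Filter.eventually_ge_atTop (t.natAbs)] with N hN
    rw [if_pos (by omega)]
  · refine Filter.Eventually.of_forall fun N t => ?_
    split_ifs
    · rw [norm_mul]
      gcongr
      exact hC _ _
    · simp; positivity

/-- Jacobi triple product. -/
lemma jtp {τ : ℂ} (hτ : 0 < τ.im) (v : ℂ) :
    ∑' t : ℤ, e2 ((t : ℂ) / 2 + (t : ℂ) * ((t : ℂ) - 1) / 2 * τ + t * v) =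
      Pinf τ * ((1 - e2 v) * ((∏' k : ℕ, (1 - e2 (v + ((k : ℂ) + 1) * τ))) *
        ∏' k : ℕ, (1 - e2 (-v + ((k : ℂ) + 1) * τ)))) := by
  have hs : Summable (fun t : ℤ => e2 ((t : ℂ) / 2 + (t : ℂ) * ((t : ℂ) - 1) / 2 * τ + t * v)) := by
    refine (summable_e2_quad (τ / 2) (1 / 2 - τ / 2 + v) 0 (by simpa using hτ)).congr fun t => ?_
    congr 1; ring
  have h1 := tannery hτ _ hs
  have h2 := ((tendsto_shift τ v hτ).mul (tendsto_shift τ (-v) hτ)).const_mul (1 - e2 v)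
  have h3 := tendsto_nhds_unique (h1.congr fun N => by
    rw [← finite_jtp τ v N, Finset.prod_mul_distrib]) h2
  rw [← h3, mul_left_comm, mul_inv_cancel₀ (Pinf_ne_zero hτ), mul_one]

lemma hasDerivAt_e2_mul (a b v : ℂ) :
    HasDerivAt (fun v => e2 (a + b * v)) (2 * Real.pi * Complex.I * b * e2 (a + b * v)) v := by
  have h : HasDerivAt (fun v : ℂ => 2 * (Real.pi : ℂ) * Complex.I * (a + b * v))
      (2 * (Real.pi : ℂ) * Complex.I * b) v := by
    have := (((hasDerivAt_id v).const_mul b).const_add a).const_mul (2 * (Real.pi : ℂ) * Complex.I)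
    simpa using this
  have := h.cexp
  rw [mul_comm (cexp _)] at this
  exact this

/-- Jacobi's identity for the cube of the eta product. -/
lemma jacobi_cube {τ : ℂ} (hτ : 0 < τ.im) :
    ∑' t : ℤ, (t : ℂ) * e2 ((t : ℂ) / 2 + (t : ℂ) * ((t : ℂ) - 1) / 2 * τ) = -Pinf τ ^ 3 := by
  have hs : Summable (fun t : ℤ => (t : ℂ) * e2 ((t : ℂ) / 2 + (t : ℂ) * ((t : ℂ) - 1) / 2 * τ)) := by
    refine (summable_mul_e2_quad (τ / 2) (1 / 2 - τ / 2) 0 (by simpa using hτ)).congr fun t => ?_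
    congr 2; ring
  have h1 := tannery hτ _ hs
  have hpi : (2 * (Real.pi : ℂ) * Complex.I) ≠ 0 := by simp [Real.pi_ne_zero]
  have fin : ∀ N : ℕ, ∑ i ∈ Finset.range (2 * N + 2),
      (((i : ℤ) - N : ℤ) : ℂ) * e2 ((((i : ℤ) - N : ℤ) : ℂ) / 2 +
        (((i : ℤ) - N : ℤ) : ℂ) * ((((i : ℤ) - N : ℤ) : ℂ) - 1) / 2 * τ) *
        gb (e2 τ) (2 * N + 1) i = -(qp (e2 τ) N * qp (e2 τ) N) := by
    intro N
    have d1 : HasDerivAt (fun v => ∑ i ∈ Finset.range (2 * N + 2),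
        e2 ((((i : ℤ) - N : ℤ) : ℂ) / 2 + (((i : ℤ) - N : ℤ) : ℂ) * ((((i : ℤ) - N : ℤ) : ℂ) - 1) / 2 * τ
          + (((i : ℤ) - N : ℤ) : ℂ) * v) * gb (e2 τ) (2 * N + 1) i) _ 0 :=
      HasDerivAt.fun_sum fun i _ => (hasDerivAt_e2_mul _ _ 0).mul_const _
    have hR : Differentiable ℂ (fun v => ∏ k ∈ Finset.range N, ((1 - e2 (v + ((k : ℂ) + 1) * τ)) *
          (1 - e2 (-v + ((k : ℂ) + 1) * τ)))) := by
      unfold e2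
      fun_prop
    have d2 := ((hasDerivAt_e2_mul 0 1 0).const_sub 1).mul (hR 0).hasDerivAt
    have d3 := d1.unique (d2.congr_of_eventuallyEq (Filter.Eventually.of_forall fun v => by
      simp only [Pi.mul_apply]
      rw [← finite_jtp τ v N]
      congr 3
      ring))
    simp only [mul_zero, add_zero, e2_zero, sub_self, zero_mul, mul_one, neg_zero, zero_add] at d3
    rw [Finset.prod_mul_distrib, ← qp_eq] at d3
    apply mul_left_cancel₀ hpi
    rw [Finset.mul_sum]
    calc _ = _ := Finset.sum_congr rfl fun i _ => by ring
      _ = _ := d3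
      _ = _ := by ring
  have h2 := ((tendsto_qp hτ).mul (tendsto_qp hτ)).neg
  have h3 := tendsto_nhds_unique (h1.congr fin) h2
  have hP := Pinf_ne_zero hτ
  rw [← div_eq_mul_inv, div_eq_iff hP] at h3
  rw [h3]; ring
/-! ### The threshold lemma -/

/-- `[K ≤ k] - [J ≤ j]` -/
def sg (J K j k : ℤ) : ℂ := (if K ≤ k then 1 else 0) - (if J ≤ j then 1 else 0)

lemma hasSum_line_left (w : ℤ → ℤ → ℂ) (J : ℤ) (h : HasSum (fun k => w J k) 0) :
    HasSum (fun p : ℤ × ℤ => if p.1 = J then w p.1 p.2 else 0) 0 := by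
  have inj : Function.Injective (fun k : ℤ => (J, k)) := fun a b hab => by simpa using hab
  refine (inj.hasSum_iff ?_).1 ?_
  · rintro ⟨j, k⟩ hx
    rw [if_neg]
    rintro rfl
    exact hx ⟨k, rfl⟩
  · simpa [Function.comp_def] using h

lemma hasSum_line_right (w : ℤ → ℤ → ℂ) (K : ℤ) (h : HasSum (fun j => w j K) 0) :
    HasSum (fun p : ℤ × ℤ => if p.2 = K then w p.1 p.2 else 0) 0 := by
  have inj : Function.Injective (fun j : ℤ => (j, K)) := fun a b hab => by simpa using hab
  refine (inj.hasSum_iff ?_).1 ?_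
  · rintro ⟨j, k⟩ hx
    rw [if_neg]
    rintro rfl
    exact hx ⟨j, rfl⟩
  · simpa [Function.comp_def] using h

lemma int_all_of_iff (P : ℤ → Prop) (h : ∀ J, P J ↔ P (J + 1)) (a b : ℤ) (ha : P a) : P b := by
  have key : ∀ d : ℤ, P (a + d) := by
    intro d
    induction d using Int.induction_on with
    | zero => simpa using ha
    | succ i ih => rw [← add_assoc]; exact (h _).1 ih
    | pred i ih => exact (h _).2 (by convert ih using 1; ring)
  simpa using key (b - a)

lemma threshold (w : ℤ → ℤ → ℂ) (hrow : ∀ k, HasSum (fun j => w j k) 0)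
    (hcol : ∀ j, HasSum (fun k => w j k) 0) (S : ℂ) (J K J' K' : ℤ)
    (h : HasSum (fun p : ℤ × ℤ => sg J K p.1 p.2 * w p.1 p.2) S) :
    HasSum (fun p : ℤ × ℤ => sg J' K' p.1 p.2 * w p.1 p.2) S := by
  have h1 : HasSum (fun p : ℤ × ℤ => sg J' K p.1 p.2 * w p.1 p.2) S := by
    refine int_all_of_iff
      (fun J => HasSum (fun p : ℤ × ℤ => sg J K p.1 p.2 * w p.1 p.2) S) (fun J => ?_) J J' h
    have hl := hasSum_line_left w J (hcol J)
    have e : ∀ p : ℤ × ℤ, sg (J + 1) K p.1 p.2 * w p.1 p.2 =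
        sg J K p.1 p.2 * w p.1 p.2 + (if p.1 = J then w p.1 p.2 else 0) := by
      rintro ⟨j, k⟩
      simp only [sg]
      rcases lt_trichotomy j J with hj | hj | hj
      · rw [if_neg (show ¬ J + 1 ≤ j by omega), if_neg (show ¬ J ≤ j by omega),
          if_neg (show ¬ j = J by omega)]; ring
      · rw [if_neg (show ¬ J + 1 ≤ j by omega), if_pos (show J ≤ j by omega),
          if_pos hj]; ring
      · rw [if_pos (show J + 1 ≤ j by omega), if_pos (show J ≤ j by omega),
          if_neg (show ¬ j = J by omega)]; ring
    constructor
    · intro hh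
      simpa [e] using hh.add hl
    · intro hh
      have := hh.sub hl
      simpa [e] using this
  refine int_all_of_iff
    (fun K => HasSum (fun p : ℤ × ℤ => sg J' K p.1 p.2 * w p.1 p.2) S) (fun K => ?_) K K' h1
  have hl := hasSum_line_right w K (hrow K)
  have e : ∀ p : ℤ × ℤ, sg J' (K + 1) p.1 p.2 * w p.1 p.2 =
      sg J' K p.1 p.2 * w p.1 p.2 - (if p.2 = K then w p.1 p.2 else 0) := by
    rintro ⟨j, k⟩
    simp only [sg]
    rcases lt_trichotomy k K with hj | hj | hj
    · rw [if_neg (show ¬ K + 1 ≤ k by omega), if_neg (show ¬ K ≤ k by omega),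
        if_neg (show ¬ k = K by omega)]; ring
    · rw [if_neg (show ¬ K + 1 ≤ k by omega), if_pos (show K ≤ k by omega),
        if_pos hj]; ring
    · rw [if_pos (show K + 1 ≤ k by omega), if_pos (show K ≤ k by omega),
        if_neg (show ¬ k = K by omega)]; ring
  constructor
  · intro hh
    simpa [e] using hh.sub hl
  · intro hh
    have := hh.add hl
    simpa [e] using this

/-! ### The coefficient summands -/

/-- summand of the coefficient of `x^u` in `N_m A`. -/
def wt (m : ℕ) (τ : ℂ) (u j k : ℤ) : ℂ :=
  e2 (((j : ℂ) + k) / 2 +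
    (((m : ℂ) + 1 / 2) * ((j : ℂ) - k + 1 / 2) ^ 2 - m * (k : ℂ) ^ 2 + k * u) * τ)

lemma wt_row (m : ℕ) {τ : ℂ} (hτ : 0 < τ.im) (u k : ℤ) : HasSum (fun j => wt m τ u j k) 0 := by
  refine hasSum_zero_of_antisymm _ ?_ (2 * k - 1) fun j => ?_
  · refine (summable_e2_quad (((m : ℂ) + 1 / 2) * τ) (1 / 2 + ((2 * m + 1) * (1 / 2 - k)) * τ)
      ((k : ℂ) / 2 + ((m + 1 / 2) * (1 / 2 - k) ^ 2 - m * (k : ℂ) ^ 2 + k * u) * τ) ?_).congr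
        fun j => ?_
    · have : (0 : ℝ) < (m : ℝ) + 1 / 2 := by positivity
      have := mul_pos this hτ
      simpa using this
    · rw [wt]; congr 1; ring
  · rw [wt, wt]
    apply e2_congr_neg (k - 1 - j)
    push_cast; ring

lemma wt_col (m : ℕ) {τ : ℂ} (hτ : 0 < τ.im) (u j : ℤ) : HasSum (fun k => wt m τ u j k) 0 := by
  refine hasSum_zero_of_antisymm _ ?_ (-2 * (u - (2 * m + 1) * j - m) + 1) fun k => ?_
  · refine (summable_e2_quad (τ / 2) (1 / 2 + ((u : ℂ) - (2 * m + 1) * (j + 1 / 2)) * τ)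
      ((j : ℂ) / 2 + ((m + 1 / 2) * (j + 1 / 2) ^ 2) * τ) (by simpa using hτ)).congr
        fun k => ?_
    rw [wt]; congr 1; ring
  · rw [wt, wt]
    apply e2_congr_neg (-(u - (2 * m + 1) * j - m) - k)
    push_cast; ring

/-- The coefficient of `x^u` in `N_m A`. -/
def Sm (m : ℕ) (τ : ℂ) (u : ℤ) : ℂ :=
  ∑' p : ℤ × ℤ, sg 1 (m + 1) p.1 p.2 * wt m τ u p.1 p.2

/-- Summand of the Appell-type function `A`. -/
def At (τ z : ℂ) (k r : ℤ) : ℂ :=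
  sg 0 0 (-r - 1) k * e2 ((k : ℂ) / 2 + ((k : ℂ) * (k + 1) / 2 + k * r) * τ + (r + 1 / 2) * (z / 2))
lemma summable_exp_abs {δ : ℝ} (hδ : 0 < δ) : Summable (fun r : ℤ => Real.exp (-δ * |(r : ℝ)|)) := by
  have h : Summable (fun n : ℕ => Real.exp (-δ * (n : ℝ))) := by
    have := summable_geometric_of_lt_one (Real.exp_nonneg (-δ)) (by rw [Real.exp_lt_one_iff]; linarith)
    refine this.congr fun n => ?_
    rw [← Real.exp_nat_mul]; congr 1; ring
  apply Summable.of_nat_of_neg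
  · simpa using h
  · simpa using h

lemma summable_At {τ z : ℂ} (hτ : 0 < τ.im) (h0 : 0 < z.im) (h1 : z.im < 2 * τ.im) :
    Summable (fun p : ℤ × ℤ => ‖At τ z p.1 p.2‖) := by
  set T := τ.im
  set Y := z.im
  have hpi := Real.pi_pos
  obtain ⟨δ, hδ, hd1, hd2⟩ : ∃ δ : ℝ, 0 < δ ∧ δ ≤ Real.pi * Y ∧ δ ≤ Real.pi * (2 * T - Y) :=
    ⟨min (Real.pi * Y) (Real.pi * (2 * T - Y)),
      lt_min (by positivity) (mul_pos hpi (by linarith)), min_le_left _ _, min_le_right _ _⟩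
  have hs1 : Summable (fun k : ℤ => ‖e2 (τ / 2 * (k : ℂ) ^ 2 + τ / 2 * k + 0)‖) :=
    (summable_e2_quad (τ / 2) (τ / 2) 0 (by simpa using hτ)).norm
  have hs := (hs1.mul_of_nonneg (summable_exp_abs hδ) (fun _ => norm_nonneg _)
    (fun _ => Real.exp_nonneg _)).mul_left (Real.exp (-(Real.pi * Y / 2)))
  refine Summable.of_nonneg_of_le (fun _ => norm_nonneg _) ?_ hs
  rintro ⟨k, r⟩
  have im1 : (((k : ℂ) / 2 + ((k : ℂ) * (k + 1) / 2 + k * r) * τ + (r + 1 / 2) * (z / 2))).im =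
      ((k : ℝ) * (k + 1) / 2 + k * r) * T + (r + 1 / 2) * (Y / 2) := by
    have : ((k : ℂ) / 2 + ((k : ℂ) * (k + 1) / 2 + k * r) * τ + (r + 1 / 2) * (z / 2)) =
      (((k : ℝ) / 2 : ℝ) : ℂ) + (((k : ℝ) * (k + 1) / 2 + k * r : ℝ) : ℂ) * τ +
        ((((r : ℝ) + 1 / 2) / 2 : ℝ) : ℂ) * z := by
      push_cast; ring
    rw [this]
    simp only [add_im, ofReal_im, im_ofReal_mul]
    ring
  have im2 : (τ / 2 * (k : ℂ) ^ 2 + τ / 2 * k + 0).im = ((k : ℝ) * (k + 1) / 2) * T := by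
    have : (τ / 2 * (k : ℂ) ^ 2 + τ / 2 * k + 0) = (((k : ℝ) * (k + 1) / 2 : ℝ) : ℂ) * τ := by
      push_cast; ring
    rw [this, im_ofReal_mul]
  simp only [At, norm_mul, norm_e2, im1, im2]
  rw [← Real.exp_add, ← Real.exp_add]
  have main : (0 ≤ k ∧ 0 ≤ r) ∨ (k < 0 ∧ r < 0) →
      Real.exp (-(2 * Real.pi * (((k : ℝ) * (k + 1) / 2 + k * r) * T + (r + 1 / 2) * (Y / 2)))) ≤
      Real.exp (-(Real.pi * Y / 2) + (-(2 * Real.pi * (((k : ℝ) * (k + 1) / 2) * T)) + -δ * |(r : ℝ)|)) := by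
    intro hkr
    rw [Real.exp_le_exp]
    have key : δ * |(r : ℝ)| ≤ 2 * Real.pi * (k * r * T) + Real.pi * (r * Y) := by
      rcases hkr with ⟨hk, hr⟩ | ⟨hk, hr⟩
      · have hk' : (0 : ℝ) ≤ k := by exact_mod_cast hk
        have hr' : (0 : ℝ) ≤ r := by exact_mod_cast hr
        rw [abs_of_nonneg hr']
        have a1 : 0 ≤ 2 * Real.pi * (k * r * T) := by positivity
        have a2 := mul_le_mul_of_nonneg_right hd1 hr'
        linarith
      · have hk' : (k : ℝ) ≤ -1 := by exact_mod_cast (by omega : k ≤ -1)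
        have hr' : (r : ℝ) < 0 := by exact_mod_cast hr
        rw [abs_of_neg hr']
        have a1 : 0 ≤ (-1 - (k : ℝ)) * (-(r : ℝ)) * (2 * Real.pi * T) := by
          apply mul_nonneg (mul_nonneg (by linarith) (by linarith)); positivity
        have a2 := mul_le_mul_of_nonneg_right hd2 (show (0 : ℝ) ≤ -r by linarith)
        nlinarith
    nlinarith
  by_cases hk : 0 ≤ k <;> by_cases hr : 0 ≤ r
  · have : sg 0 0 (-r - 1) k = 1 := by
      rw [sg, if_pos hk, if_neg (by omega)]; ring
    rw [this, norm_one, one_mul]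
    exact main (Or.inl ⟨hk, hr⟩)
  · have : sg 0 0 (-r - 1) k = 0 := by
      rw [sg, if_pos hk, if_pos (by omega)]; ring
    rw [this, norm_zero, zero_mul]
    exact Real.exp_nonneg _
  · have : sg 0 0 (-r - 1) k = 0 := by
      rw [sg, if_neg hk, if_neg (by omega)]; ring
    rw [this, norm_zero, zero_mul]
    exact Real.exp_nonneg _
  · have : sg 0 0 (-r - 1) k = -1 := by
      rw [sg, if_neg hk, if_pos (by omega)]; ring
    rw [this, norm_neg, norm_one, one_mul]
    exact main (Or.inr ⟨by omega, by omega⟩)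

/-- The Appell-type function `A`. -/
def Afun (τ z : ℂ) : ℂ := ∑' p : ℤ × ℤ, At τ z p.1 p.2

/-- The numerator theta. -/
def Nt (m : ℕ) (τ z : ℂ) : ℂ := jtheta (-1) ((m : ℂ) + 1 / 2) ((m : ℂ) + 1 / 2) τ z

/-- Summand of `Nt`. -/
def Nterm (m : ℕ) (τ z : ℂ) (j : ℤ) : ℂ :=
  e2 ((j : ℂ) / 2 + ((m : ℂ) + 1 / 2) * ((j : ℂ) + 1 / 2) ^ 2 * τ +
    ((m : ℂ) + 1 / 2) * ((j : ℂ) + 1 / 2) * z)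

lemma m_half_ne (m : ℕ) : (m : ℂ) + 1 / 2 ≠ 0 := by
  have h : (((m : ℝ) + 1 / 2 : ℝ) : ℂ) ≠ 0 := by
    rw [Ne, Complex.ofReal_eq_zero]
    positivity
  simpa using h

lemma Nt_eq (m : ℕ) (τ z : ℂ) : Nt m τ z = ∑' j : ℤ, Nterm m τ z j := by
  rw [Nt, jtheta]
  refine tsum_congr fun j => ?_
  have h : ((m : ℂ) + 1 / 2) / (2 * ((m : ℂ) + 1 / 2)) = 1 / 2 := by
    rw [div_eq_iff (mul_ne_zero two_ne_zero (m_half_ne m))]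
    ring
  rw [h, neg_one_zpow_e2, ← e2_add, Nterm, add_assoc]

lemma summable_Nterm (m : ℕ) {τ : ℂ} (hτ : 0 < τ.im) (z : ℂ) : Summable (Nterm m τ z) := by
  refine (summable_e2_quad (((m : ℂ) + 1 / 2) * τ) (1 / 2 + (m + 1 / 2) * (τ + z))
      (((m : ℂ) + 1 / 2) * (τ / 4 + z / 2)) ?_).congr fun j => ?_
  · have : (0 : ℝ) < (m : ℝ) + 1 / 2 := by positivity
    have := mul_pos this hτ
    simpa using this
  · rw [Nterm]; congr 1; ring

/-- Reindexing `(u,(j,k)) ↦ (j,(k,r))`. -/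
def reidx (m : ℕ) : ℤ × (ℤ × ℤ) ≃ ℤ × (ℤ × ℤ) where
  toFun p := (p.2.1, (p.2.2, p.1 - (2 * m + 1) * p.2.1 - m - 1))
  invFun p := (p.2.2 + (2 * m + 1) * p.1 + m + 1, (p.1, p.2.1))
  left_inv p := by
    ext
    · simp only []; ring
    · rfl
    · rfl
  right_inv p := by
    ext
    · rfl
    · rfl
    · simp only []; ring

lemma NA_term (m : ℕ) (τ z : ℂ) (u j k : ℤ) :
    Nterm m τ z j * At τ z k (u - (2 * m + 1) * j - m - 1) =
      sg ((u - m - 1) / (2 * m + 1) + 1) 0 j k * wt m τ u j k * e2 (u * (z / 2)) := by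
  have h1 : sg 0 0 (-(u - (2 * m + 1) * j - m - 1) - 1) k =
      sg ((u - m - 1) / (2 * m + 1) + 1) 0 j k := by
    have h : (0 ≤ -(u - (2 * m + 1) * j - m - 1) - 1) ↔ ((u - m - 1) / (2 * m + 1) + 1 ≤ j) := by
      rw [Int.add_one_le_iff, Int.ediv_lt_iff_lt_mul (by positivity), mul_comm j]
      constructor <;> intro h <;> linarith
    simp only [sg, h]
  rw [At, h1, Nterm, wt, mul_left_comm, ← e2_add, mul_assoc (sg _ _ _ _), ← e2_add]
  congr 2
  push_cast; ring

lemma NA_main (m : ℕ) {τ z : ℂ} (hτ : 0 < τ.im) (h0 : 0 < z.im) (h1 : z.im < 2 * τ.im) :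
    (∀ u, ∃ J K, HasSum (fun p : ℤ × ℤ => sg J K p.1 p.2 * wt m τ u p.1 p.2) (Sm m τ u)) ∧
    HasSum (fun u : ℤ => Sm m τ u * e2 (u * (z / 2))) (Nt m τ z * Afun τ z) := by
  have hN := (summable_Nterm m hτ z).norm
  have hA := summable_At hτ h0 h1
  have hprod : HasSum (fun p : ℤ × (ℤ × ℤ) => Nterm m τ z p.1 * At τ z p.2.1 p.2.2)
      (Nt m τ z * Afun τ z) := by
    rw [Nt_eq, Afun, tsum_mul_tsum_of_summable_norm hN hA]
    exact (summable_mul_of_summable_norm hN hA).hasSum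
  have hre := (reidx m).hasSum_iff.2 hprod
  have hre2 : HasSum (fun p : ℤ × (ℤ × ℤ) =>
      sg ((p.1 - m - 1) / (2 * m + 1) + 1) 0 p.2.1 p.2.2 * wt m τ p.1 p.2.1 p.2.2 *
        e2 (p.1 * (z / 2))) (Nt m τ z * Afun τ z) := by
    refine hre.congr_fun ?_
    rintro ⟨u, j, k⟩
    exact (NA_term m τ z u j k).symm
  have hu : ∀ u : ℤ, HasSum (fun p : ℤ × ℤ => sg ((u - m - 1) / (2 * m + 1) + 1) 0 p.1 p.2 *
      wt m τ u p.1 p.2) (Sm m τ u) := by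
    intro u
    have hs : Summable (fun p : ℤ × ℤ => sg ((u - m - 1) / (2 * m + 1) + 1) 0 p.1 p.2 *
      wt m τ u p.1 p.2 * e2 (u * (z / 2))) := hre2.summable.prod_factor u
    have hs2 : Summable (fun p : ℤ × ℤ => sg ((u - m - 1) / (2 * m + 1) + 1) 0 p.1 p.2 *
      wt m τ u p.1 p.2) := (summable_mul_right_iff (e2_ne_zero _)).1 hs
    have := threshold (wt m τ u) (wt_row m hτ u) (wt_col m hτ u) _ _ _ 1 (m + 1) hs2.hasSum
    rw [Sm, this.tsum_eq]
    exact hs2.hasSum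
  refine ⟨fun u => ⟨_, _, hu u⟩, ?_⟩
  refine hre2.prod_fiberwise (g := fun u : ℤ => Sm m τ u * e2 (u * (z / 2))) fun u => ?_
  exact (hu u).mul_right (e2 (u * (z / 2)))

lemma hasSum_Sm (m : ℕ) {τ : ℂ} (hτ : 0 < τ.im) (u J K : ℤ) :
    HasSum (fun p : ℤ × ℤ => sg J K p.1 p.2 * wt m τ u p.1 p.2) (Sm m τ u) := by
  obtain ⟨J', K', h⟩ := (NA_main m (z := τ) hτ hτ (by linarith)).1 u
  exact threshold (wt m τ u) (wt_row m hτ u) (wt_col m hτ u) _ _ _ J K h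

lemma Sm_shift (m : ℕ) {τ : ℂ} (hτ : 0 < τ.im) (u : ℤ) :
    Sm m τ (u + 2 * m) = e2 ((m + u) * τ) * Sm m τ u := by
  have h1 := hasSum_Sm m hτ (u + 2 * m) 1 1
  have h2 := (hasSum_Sm m hτ u 0 0).mul_left (e2 ((m + u) * τ))
  have h3 := ((Equiv.addRight (1 : ℤ)).prodCongr (Equiv.addRight (1 : ℤ))).hasSum_iff.2 h1
  refine h3.unique (h2.congr_fun ?_)
  rintro ⟨j, k⟩
  simp only [Function.comp, Equiv.prodCongr_apply, Prod.map, Equiv.coe_addRight]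
  have e1 : sg 1 1 (j + 1) (k + 1) = sg 0 0 j k := by
    simp only [sg]
    congr 2 <;> simp
  rw [e1, mul_left_comm, wt, wt, ← e2_add]
  congr 1
  apply e2_congr 1
  push_cast; ring

lemma Sm_zero_of_ne {τ : ℂ} (hτ : 0 < τ.im) (u : ℤ) (hu : u ≠ 0) : Sm 0 τ u = 0 := by
  have h := Sm_shift 0 hτ u
  simp only [Nat.cast_zero, mul_zero, add_zero, zero_add] at h
  have h1 : e2 (u * τ) ≠ 1 := by
    rw [Ne, e2_eq_one_iff]
    rintro ⟨n, hn⟩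
    have := congrArg Complex.im hn
    simp at this
    rcases this with h | h
    · exact hu h
    · exact hτ.ne' h
  have h2 : (1 - e2 (u * τ)) * Sm 0 τ u = 0 := by linear_combination h
  rcases mul_eq_zero.1 h2 with h3 | h3
  · exact absurd (sub_eq_zero.1 h3).symm h1
  · exact h3

lemma hasSum_ind (c : ℤ) :
    HasSum (fun k : ℤ => ((if 0 ≤ k then 1 else 0) - (if c ≤ k then 1 else 0) : ℂ)) c := by
  have step : ∀ c : ℤ,
      HasSum (fun k : ℤ => ((if 0 ≤ k then 1 else 0) - (if c ≤ k then 1 else 0) : ℂ)) c ↔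
      HasSum (fun k : ℤ => ((if 0 ≤ k then 1 else 0) - (if c + 1 ≤ k then 1 else 0) : ℂ))
        ((c + 1 : ℤ) : ℂ) := by
    intro c
    have h1 : HasSum (fun k : ℤ => if k = c then (1 : ℂ) else 0) 1 := hasSum_ite_eq c 1
    have e : ∀ k : ℤ, ((if 0 ≤ k then 1 else 0) - (if c + 1 ≤ k then 1 else 0) : ℂ) =
        ((if 0 ≤ k then 1 else 0) - (if c ≤ k then 1 else 0)) + if k = c then (1 : ℂ) else 0 := by
      intro k
      rcases lt_trichotomy k c with hj | hj | hj
      · rw [if_neg (show ¬ c + 1 ≤ k by omega), if_neg (show ¬ c ≤ k by omega),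
          if_neg (show ¬ k = c by omega)]; ring
      · rw [if_neg (show ¬ c + 1 ≤ k by omega), if_pos (show c ≤ k by omega),
          if_pos hj]; ring
      · rw [if_pos (show c + 1 ≤ k by omega), if_pos (show c ≤ k by omega),
          if_neg (show ¬ k = c by omega)]; ring
    simp only [e]
    constructor
    · intro h
      simpa using h.add h1
    · intro h
      have := h.sub h1
      simpa using this
  refine int_all_of_iff (fun c => HasSum (fun k : ℤ =>
    ((if 0 ≤ k then 1 else 0) - (if c ≤ k then 1 else 0) : ℂ)) c) step 0 c ?_
  simp [hasSum_zero]

/-- Reindexing `(t,k) ↦ (t+k,k)`. -/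
def diagidx : ℤ × ℤ ≃ ℤ × ℤ where
  toFun p := (p.1 + p.2, p.2)
  invFun p := (p.1 - p.2, p.2)
  left_inv p := by ext <;> simp
  right_inv p := by ext <;> simp

lemma Sm_zero_zero {τ : ℂ} (hτ : 0 < τ.im) : Sm 0 τ 0 = -dedekindEta τ ^ 3 := by
  have h1 := diagidx.hasSum_iff.2 (hasSum_Sm 0 hτ 0 0 0)
  have h2 : HasSum (fun p : ℤ × ℤ => ((if 0 ≤ p.2 then 1 else 0) - (if -p.1 ≤ p.2 then 1 else 0) : ℂ) *
      e2 ((p.1 : ℂ) / 2 + ((p.1 : ℂ) + 1 / 2) ^ 2 / 2 * τ)) (Sm 0 τ 0) := by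
    refine h1.congr_fun ?_
    rintro ⟨t, k⟩
    simp only [Function.comp, diagidx, Equiv.coe_fn_mk, sg]
    have e1 : (-t ≤ k) ↔ 0 ≤ t + k := by constructor <;> intro h <;> linarith
    simp only [e1]
    congr 1
    rw [wt]
    symm
    apply e2_congr k
    push_cast; ring
  have h3 := h2.prod_fiberwise (g := fun t : ℤ => ((-t : ℤ) : ℂ) *
      e2 ((t : ℂ) / 2 + ((t : ℂ) + 1 / 2) ^ 2 / 2 * τ)) (fun t => (hasSum_ind (-t)).mul_right
      (e2 ((t : ℂ) / 2 + ((t : ℂ) + 1 / 2) ^ 2 / 2 * τ)))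
  have h4 := (Equiv.neg ℤ).hasSum_iff.2 h3
  have h5 := jacobi_cube hτ
  have h6 : dedekindEta τ ^ 3 = e2 (τ / 8) * Pinf τ ^ 3 := by
    rw [dedekindEta, ← Pinf, mul_pow, ← e2_pow]
    congr 2
    push_cast; ring
  rw [h6, ← h4.tsum_eq, neg_mul_eq_mul_neg, ← h5, ← tsum_mul_left]
  refine tsum_congr fun t => ?_
  simp only [Function.comp, Equiv.neg_apply]
  have : e2 (((-t : ℤ) : ℂ) / 2 + (((-t : ℤ) : ℂ) + 1 / 2) ^ 2 / 2 * τ) =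
      e2 (τ / 8) * e2 ((t : ℂ) / 2 + (t : ℂ) * ((t : ℂ) - 1) / 2 * τ) := by
    rw [← e2_add]
    apply e2_congr (-t)
    push_cast; ring
  rw [this]
  push_cast; ring

lemma theta_mul_A {τ z : ℂ} (hτ : 0 < τ.im) (h0 : 0 < z.im) (h1 : z.im < 2 * τ.im) :
    Nt 0 τ z * Afun τ z = -dedekindEta τ ^ 3 := by
  have h := (NA_main 0 hτ h0 h1).2
  have h2 : HasSum (fun u : ℤ => Sm 0 τ u * e2 (u * (z / 2))) (Sm 0 τ 0 * e2 ((0 : ℤ) * (z / 2))) :=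
    hasSum_single 0 fun u hu => by rw [Sm_zero_of_ne hτ u hu, zero_mul]
  rw [h.unique h2, Sm_zero_zero hτ]
  simp [e2_zero]
/-! ### Final assembly -/

lemma eta_ne {τ : ℂ} (hτ : 0 < τ.im) : dedekindEta τ ≠ 0 :=
  mul_ne_zero (e2_ne_zero _) (Pinf_ne_zero hτ)

lemma Nt_zero_at_zero (m : ℕ) {τ : ℂ} (hτ : 0 < τ.im) : Nt m τ 0 = 0 := by
  rw [Nt_eq]
  refine (hasSum_zero_of_antisymm _ (summable_Nterm m hτ 0) (-1) fun j => ?_).tsum_eq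
  rw [Nterm, Nterm]
  apply e2_congr_neg (-1 - j)
  push_cast; ring

lemma theta_ne {τ z : ℂ} (hτ : 0 < τ.im) (h : ∀ a b : ℤ, z ≠ 2 * a + 2 * b * τ) :
    Nt 0 τ z ≠ 0 := by
  have key : ∀ c : ℤ, e2 (z / 2 + c * τ) ≠ 1 := by
    intro c hc
    obtain ⟨n, hn⟩ := (e2_eq_one_iff _).1 hc
    apply h n (-c)
    push_cast
    linear_combination 2 * hn
  have e : Nt 0 τ z = e2 (τ / 8 + z / 4) *
      ∑' t : ℤ, e2 ((t : ℂ) / 2 + (t : ℂ) * ((t : ℂ) - 1) / 2 * τ + t * (z / 2 + τ)) := by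
    rw [Nt_eq, ← tsum_mul_left]
    refine tsum_congr fun t => ?_
    rw [Nterm, ← e2_add]
    congr 1
    push_cast; ring
  rw [e, jtp hτ]
  refine mul_ne_zero (e2_ne_zero _) (mul_ne_zero (Pinf_ne_zero hτ) (mul_ne_zero ?_
    (mul_ne_zero (tprod_shift_ne_zero _ _ hτ fun k => ?_)
      (tprod_shift_ne_zero _ _ hτ fun k => ?_))))
  · have := key 1
    rw [Int.cast_one, one_mul] at this
    exact sub_ne_zero.2 this.symm
  · have := key (k + 2)
    rw [show z / 2 + τ + ((k : ℂ) + 1) * τ = z / 2 + ((k + 2 : ℤ) : ℂ) * τ by push_cast; ring]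
    exact this
  · have := key (-k)
    intro h1
    apply this
    have h2 : e2 (z / 2 + ((-k : ℤ) : ℂ) * τ) * e2 (-(z / 2 + τ) + ((k : ℂ) + 1) * τ) = 1 := by
      rw [← e2_add, show z / 2 + ((-k : ℤ) : ℂ) * τ + (-(z / 2 + τ) + ((k : ℂ) + 1) * τ) = 0 by
        push_cast; ring, e2_zero]
    rwa [h1, mul_one] at h2

lemma differentiable_Nt (m : ℕ) {τ : ℂ} (hτ : 0 < τ.im) : Differentiable ℂ (Nt m τ) := by
  have e : Nt m τ = fun z => e2 (((m : ℂ) + 1 / 2) * (τ / 4 + z / 2)) *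
      jacobiTheta₂ (1 / 2 + (m + 1 / 2) * (τ + z)) (2 * (((m : ℂ) + 1 / 2) * τ)) := by
    funext z
    rw [Nt_eq, ← tsum_e2_quad]
    refine tsum_congr fun j => ?_
    rw [Nterm]; congr 1; ring
  have him : 0 < (2 * (((m : ℂ) + 1 / 2) * τ)).im := by
    have : (0 : ℝ) < (m : ℝ) + 1 / 2 := by positivity
    have := mul_pos this hτ
    simpa using this
  rw [e]
  intro z
  refine DifferentiableAt.mul (by unfold e2; fun_prop) ?_
  exact (differentiableAt_jacobiTheta₂_fst _ him).comp z
    (f := fun z : ℂ => 1 / 2 + ((m : ℂ) + 1 / 2) * (τ + z)) (by fun_prop)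

lemma jtheta_one_term (m : ℕ) (hm : 0 < m) (n : ℤ) (τ z : ℂ) :
    jtheta 1 n m τ z = ∑' i : ℤ, e2 ((m * τ) * (i : ℂ) ^ 2 + (n * τ + m * z) * i +
      ((n : ℂ) ^ 2 / (4 * m) * τ + n * z / 2)) := by
  have hm' : (m : ℂ) ≠ 0 := by exact_mod_cast hm.ne'
  rw [jtheta]
  refine tsum_congr fun i => ?_
  rw [one_zpow, one_mul]
  congr 1
  field_simp
  ring

lemma im_m_pos (m : ℕ) (hm : 0 < m) {τ : ℂ} (hτ : 0 < τ.im) : 0 < ((m : ℂ) * τ).im := by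
  have : (0 : ℝ) < (m : ℝ) := by exact_mod_cast hm
  have := mul_pos this hτ
  simpa using this

lemma differentiable_jtheta_one (m : ℕ) (hm : 0 < m) (n : ℤ) {τ : ℂ} (hτ : 0 < τ.im) :
    Differentiable ℂ (fun z => jtheta 1 n m τ z) := by
  have him : 0 < (2 * ((m : ℂ) * τ)).im := by simpa using im_m_pos m hm hτ
  simp only [jtheta_one_term m hm, tsum_e2_quad]
  intro z
  refine DifferentiableAt.mul (by unfold e2; fun_prop) ?_
  exact (differentiableAt_jacobiTheta₂_fst _ him).comp z
    (f := fun z : ℂ => (n : ℂ) * τ + m * z) (by fun_prop)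

lemma Sm_period (m : ℕ) {τ : ℂ} (hτ : 0 < τ.im) (n i : ℤ) :
    Sm m τ (n + 2 * m * i) = e2 ((m * (i : ℂ) ^ 2 + n * i) * τ) * Sm m τ n := by
  refine int_all_of_iff (fun i => Sm m τ (n + 2 * m * i) =
    e2 ((m * (i : ℂ) ^ 2 + n * i) * τ) * Sm m τ n) (fun i => ?_) 0 i (by simp [e2_zero])
  have h := Sm_shift m hτ (n + 2 * m * i)
  rw [show n + 2 * (m : ℤ) * (i + 1) = n + 2 * m * i + 2 * m by ring, h]
  have e : e2 ((m * ((i + 1 : ℤ) : ℂ) ^ 2 + n * (i + 1 : ℤ)) * τ) =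
      e2 ((m + (n + 2 * m * i : ℤ)) * τ) * e2 ((m * (i : ℂ) ^ 2 + n * i) * τ) := by
    rw [← e2_add]; congr 1; push_cast; ring
  rw [e]
  constructor
  · intro h; rw [h]; ring
  · intro h
    apply mul_left_cancel₀ (e2_ne_zero ((m + (n + 2 * m * i : ℤ)) * τ))
    rw [h]; ring

/-- Reindexing `(j,k) ↦ (k-m-j, k-m)`. -/
def gidx (m : ℕ) : ℤ × ℤ ≃ ℤ × ℤ where
  toFun p := (p.2 - m - p.1, p.2 - m)
  invFun p := (p.2 - p.1, p.2 + m)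
  left_inv p := by ext <;> simp
  right_inv p := by ext <;> simp

lemma Sm_gfun (m : ℕ) (hm : 0 < m) (n : ℤ) (τ : ℂ) :
    Sm m τ n = e2 ((n : ℂ) ^ 2 / (4 * m) * τ) * (-1) ^ m * gfun m n m τ := by
  have hm' : (m : ℂ) ≠ 0 := by exact_mod_cast hm.ne'
  rw [gfun, indefSum, ← (gidx m).tsum_eq, Sm, ← tsum_mul_left]
  refine tsum_congr ?_
  rintro ⟨j, k⟩
  have hp : gidx m (j, k) = (k - m - j, k - m) := rfl
  rw [hp]
  dsimp only
  have h1 : ∀ x : ℂ, ((if 0 < k - m ∧ k - m ≤ k - m - j then x else 0) -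
      (if k - m - j < k - m ∧ k - m ≤ 0 then x else 0)) = sg 1 (m + 1) j k * x := by
    intro x
    simp only [sg]
    by_cases hk : (m : ℤ) + 1 ≤ k <;> by_cases hj : 1 ≤ j
    · rw [if_neg (by omega), if_neg (by omega), if_pos hk, if_pos hj]; ring
    · rw [if_pos (by omega), if_neg (by omega), if_pos hk, if_neg hj]; ring
    · rw [if_neg (by omega), if_pos (by omega), if_neg hk, if_pos hj]; ring
    · rw [if_neg (by omega), if_neg (by omega), if_neg hk, if_neg hj]; ring
  rw [h1, mul_left_comm]
  congr 1
  rw [neg_one_zpow_e2, ← zpow_natCast (-1 : ℂ) m, neg_one_zpow_e2, wt, ← e2_add, ← e2_add, ← e2_add]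
  have h2 : (((m : ℤ) : ℂ) + 1 / 2) / (2 * (m : ℂ) + 1) = 1 / 2 := by
    have : 2 * (m : ℂ) + 1 ≠ 0 := by
      have := m_half_ne m
      intro h; apply this; linear_combination h / 2
    push_cast
    rw [div_eq_iff this]; ring
  rw [h2]
  apply e2_congr j
  push_cast
  field_simp
  ring

lemma root_sum (m : ℕ) (hm : 0 < m) (d : ℤ) :
    ∑ ℓ ∈ Finset.range (2 * m), e2 ((d : ℂ) * ℓ / (2 * m)) =
      if (2 * (m : ℤ)) ∣ d then 2 * (m : ℂ) else 0 := by
  have hm' : (m : ℂ) ≠ 0 := by exact_mod_cast hm.ne'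
  have e : ∀ ℓ : ℕ, e2 ((d : ℂ) * ℓ / (2 * m)) = e2 ((d : ℂ) / (2 * m)) ^ ℓ := by
    intro ℓ
    rw [← e2_pow]; congr 1; ring
  simp only [e]
  split_ifs with h
  · obtain ⟨c, rfl⟩ := h
    have : e2 (((2 * (m : ℤ) * c : ℤ) : ℂ) / (2 * m)) = 1 := by
      rw [e2_eq_one_iff]
      exact ⟨c, by push_cast; field_simp⟩
    rw [Finset.sum_congr rfl (fun x _ => by rw [this, one_pow])]
    simp
  · have h1 : e2 ((d : ℂ) / (2 * m)) ≠ 1 := by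
      rw [Ne, e2_eq_one_iff]
      rintro ⟨c, hc⟩
      apply h
      refine ⟨c, ?_⟩
      rw [div_eq_iff (by simpa using hm')] at hc
      have : (d : ℂ) = ((2 * m * c : ℤ) : ℂ) := by rw [hc]; push_cast; ring
      exact_mod_cast this
    rw [geom_sum_eq h1, ← e2_pow]
    have : e2 (((2 * m : ℕ) : ℂ) * ((d : ℂ) / (2 * m))) = 1 := by
      rw [e2_eq_one_iff]
      exact ⟨d, by push_cast; field_simp⟩
    rw [this]; simp

lemma annulus (m : ℕ) (hm : 0 < m) (n : ℤ) {τ z : ℂ} (hτ : 0 < τ.im) (h0 : 0 < z.im)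
    (h1 : z.im < 2 * τ.im) :
    gfun m n m τ * jtheta 1 n m τ z = -((-1 : ℂ) ^ m / (2 * (m : ℂ))) * dedekindEta τ ^ 3 *
      ∑ ℓ ∈ Finset.range (2 * m), e2 ((n : ℂ) * (ℓ : ℂ) / (2 * (m : ℂ))) *
        (Nt m τ (z - (ℓ : ℂ) / (m : ℂ)) / Nt 0 τ (z - (ℓ : ℂ) / (m : ℂ))) := by
  have hm' : (m : ℂ) ≠ 0 := by exact_mod_cast hm.ne'
  have hη : dedekindEta τ ^ 3 ≠ 0 := pow_ne_zero _ (eta_ne hτ)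
  have him : ∀ ℓ : ℕ, (z - (ℓ : ℂ) / (m : ℂ)).im = z.im := by
    intro ℓ
    have : (ℓ : ℂ) / (m : ℂ) = (((ℓ : ℝ) / (m : ℝ) : ℝ) : ℂ) := by push_cast; rfl
    rw [this, sub_im, ofReal_im, sub_zero]
  have hq : ∀ ℓ : ℕ, Nt m τ (z - (ℓ : ℂ) / (m : ℂ)) / Nt 0 τ (z - (ℓ : ℂ) / (m : ℂ)) =
      -(dedekindEta τ ^ 3)⁻¹ *
        (Nt m τ (z - (ℓ : ℂ) / (m : ℂ)) * Afun τ (z - (ℓ : ℂ) / (m : ℂ))) := by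
    intro ℓ
    have hA := theta_mul_A (z := z - (ℓ : ℂ) / (m : ℂ)) hτ (by rw [him]; exact h0)
      (by rw [him]; exact h1)
    have hne : Nt 0 τ (z - (ℓ : ℂ) / (m : ℂ)) ≠ 0 := by
      intro h; rw [h, zero_mul] at hA
      exact hη (by linear_combination hA)
    rw [div_eq_iff hne]
    have : -(dedekindEta τ ^ 3)⁻¹ * -dedekindEta τ ^ 3 = 1 := by
      rw [neg_mul_neg, inv_mul_cancel₀ hη]
    linear_combination (-Nt m τ (z - (ℓ : ℂ) / (m : ℂ))) * this +
      (Nt m τ (z - (ℓ : ℂ) / (m : ℂ)) * (dedekindEta τ ^ 3)⁻¹) * hA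
  -- the projected sum
  have hs1 : HasSum (fun u : ℤ => ∑ ℓ ∈ Finset.range (2 * m), e2 ((n : ℂ) * (ℓ : ℂ) / (2 * (m : ℂ))) *
      (Sm m τ u * e2 (u * ((z - (ℓ : ℂ) / (m : ℂ)) / 2))))
      (∑ ℓ ∈ Finset.range (2 * m), e2 ((n : ℂ) * (ℓ : ℂ) / (2 * (m : ℂ))) *
        (Nt m τ (z - (ℓ : ℂ) / (m : ℂ)) * Afun τ (z - (ℓ : ℂ) / (m : ℂ)))) := by
    refine hasSum_sum fun ℓ _ => HasSum.mul_left _ ?_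
    exact (NA_main m hτ (by rw [him]; exact h0) (by rw [him]; exact h1)).2
  have hs2 : HasSum (fun u : ℤ => (if (2 * (m : ℤ)) ∣ n - u then 2 * (m : ℂ) else 0) *
      (Sm m τ u * e2 (u * (z / 2))))
      (∑ ℓ ∈ Finset.range (2 * m), e2 ((n : ℂ) * (ℓ : ℂ) / (2 * (m : ℂ))) *
        (Nt m τ (z - (ℓ : ℂ) / (m : ℂ)) * Afun τ (z - (ℓ : ℂ) / (m : ℂ)))) := by
    refine hs1.congr_fun fun u => ?_
    rw [← root_sum m hm, Finset.sum_mul]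
    refine Finset.sum_congr rfl fun ℓ _ => ?_
    rw [mul_left_comm, mul_left_comm (e2 ((n : ℂ) * (ℓ : ℂ) / (2 * (m : ℂ)))), ← e2_add, ← e2_add]
    congr 2
    push_cast
    field_simp
    ring
  have hinj : Function.Injective (fun i : ℤ => n + 2 * (m : ℤ) * i) := by
    intro a b hab
    have hm2 : (2 * (m : ℤ)) ≠ 0 := by positivity
    exact mul_left_cancel₀ hm2 (add_left_cancel hab)
  have hs3 := (hinj.hasSum_iff (f := fun u : ℤ => (if (2 * (m : ℤ)) ∣ n - u then 2 * (m : ℂ) else 0) *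
      (Sm m τ u * e2 (u * (z / 2)))) (by
    intro u hu
    rw [if_neg, zero_mul]
    rintro ⟨c, hc⟩
    exact hu ⟨-c, by beta_reduce; linarith⟩)).2 hs2
  have hs4 : HasSum (fun i : ℤ => (2 * (m : ℂ) * (-1) ^ m * gfun m n m τ) *
      e2 ((m * τ) * (i : ℂ) ^ 2 + (n * τ + m * z) * i +
      ((n : ℂ) ^ 2 / (4 * m) * τ + n * z / 2)))
      (∑ ℓ ∈ Finset.range (2 * m), e2 ((n : ℂ) * (ℓ : ℂ) / (2 * (m : ℂ))) *
        (Nt m τ (z - (ℓ : ℂ) / (m : ℂ)) * Afun τ (z - (ℓ : ℂ) / (m : ℂ)))) := by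
    refine hs3.congr_fun fun i => ?_
    simp only [Function.comp]
    rw [if_pos ⟨-i, by ring⟩, Sm_period m hτ, Sm_gfun m hm]
    have e : e2 ((m * τ) * (i : ℂ) ^ 2 + (n * τ + m * z) * i +
      ((n : ℂ) ^ 2 / (4 * m) * τ + n * z / 2)) = e2 ((m * (i : ℂ) ^ 2 + n * i) * τ) *
        e2 ((n : ℂ) ^ 2 / (4 * m) * τ) * e2 (((n + 2 * m * i : ℤ) : ℂ) * (z / 2)) := by
      rw [← e2_add, ← e2_add]; congr 1; push_cast; ring
    rw [e]; ring
  have hs5 := hs4.tsum_eq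
  rw [tsum_mul_left, ← jtheta_one_term m hm] at hs5
  have hfin : ∑ ℓ ∈ Finset.range (2 * m), e2 ((n : ℂ) * (ℓ : ℂ) / (2 * (m : ℂ))) *
        (Nt m τ (z - (ℓ : ℂ) / (m : ℂ)) / Nt 0 τ (z - (ℓ : ℂ) / (m : ℂ))) =
      -(dedekindEta τ ^ 3)⁻¹ * (2 * (m : ℂ) * (-1) ^ m * gfun m n m τ * jtheta 1 n m τ z) := by
    rw [hs5, Finset.mul_sum]
    refine Finset.sum_congr rfl fun ℓ _ => ?_
    rw [hq]; ring
  rw [hfin]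
  have hsq : ((-1 : ℂ) ^ m) * (-1) ^ m = 1 := by
    rw [← mul_pow]; simp
  have hmm : (2 * (m : ℂ))⁻¹ * (2 * m) = 1 := inv_mul_cancel₀ (by simpa using hm')
  have hee : dedekindEta τ ^ 3 * (dedekindEta τ ^ 3)⁻¹ = 1 := mul_inv_cancel₀ hη
  calc gfun m n m τ * jtheta 1 n m τ z
      = (((-1 : ℂ) ^ m) * (-1) ^ m) * ((2 * (m : ℂ))⁻¹ * (2 * m)) *
        (dedekindEta τ ^ 3 * (dedekindEta τ ^ 3)⁻¹) * (gfun m n m τ * jtheta 1 n m τ z) := by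
          rw [hsq, hmm, hee]; ring
    _ = _ := by rw [div_eq_mul_inv]; ring

lemma all_z (m : ℕ) (hm : 0 < m) (n : ℤ) {τ z : ℂ} (hτ : 0 < τ.im)
    (hz : ∀ a b : ℤ, (m : ℂ) * z ≠ (a : ℂ) + (b : ℂ) * τ) :
    gfun m n m τ * jtheta 1 n m τ z = -((-1 : ℂ) ^ m / (2 * (m : ℂ))) * dedekindEta τ ^ 3 *
      ∑ ℓ ∈ Finset.range (2 * m), e2 ((n : ℂ) * (ℓ : ℂ) / (2 * (m : ℂ))) *
        (Nt m τ (z - (ℓ : ℂ) / (m : ℂ)) / Nt 0 τ (z - (ℓ : ℂ) / (m : ℂ))) := by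
  have hm' : (m : ℂ) ≠ 0 := by exact_mod_cast hm.ne'
  set U : Set ℂ := {z | ∀ ℓ ∈ Finset.range (2 * m), Nt 0 τ (z - (ℓ : ℂ) / (m : ℂ)) ≠ 0} with hU
  have hsub : ∀ z : ℂ, (∀ a b : ℤ, (m : ℂ) * z ≠ (a : ℂ) + (b : ℂ) * τ) → z ∈ U := by
    intro z hz ℓ _
    apply theta_ne hτ
    intro a b hab
    apply hz (2 * m * a + ℓ) (2 * m * b)
    have : z = 2 * a + 2 * b * τ + (ℓ : ℂ) / m := by linear_combination hab
    rw [this]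
    push_cast
    field_simp
    ring
  have hUo : IsOpen U := by
    have : U = ⋂ ℓ ∈ Finset.range (2 * m), {z | Nt 0 τ (z - (ℓ : ℂ) / (m : ℂ)) ≠ 0} := by
      ext z; simp [hU]
    rw [this]
    refine isOpen_biInter_finset fun ℓ _ => ?_
    have hc : Continuous (fun z => Nt 0 τ (z - (ℓ : ℂ) / (m : ℂ))) :=
      (differentiable_Nt 0 hτ).continuous.comp (by fun_prop)
    exact isOpen_ne_fun hc continuous_const
  have hcount : (Uᶜ).Countable := by
    refine (Set.countable_range (fun p : ℤ × ℤ => ((p.1 : ℂ) + p.2 * τ) / m)).mono ?_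
    intro z hzU
    by_contra hne
    apply hzU
    apply hsub
    intro a b hab
    apply hne
    refine ⟨(a, b), ?_⟩
    simp only []
    rw [← hab]
    field_simp
  have hconn : IsPreconnected U := by
    have := (hcount.isConnected_compl_of_one_lt_rank (by simp)).isPreconnected
    rwa [compl_compl] at this
  have hf : AnalyticOnNhd ℂ (fun z => gfun m n m τ * jtheta 1 n m τ z) U := by
    apply DifferentiableOn.analyticOnNhd _ hUo
    exact ((differentiable_jtheta_one m hm n hτ).const_mul _).differentiableOn
  have hg : AnalyticOnNhd ℂ (fun z => -((-1 : ℂ) ^ m / (2 * (m : ℂ))) * dedekindEta τ ^ 3 *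
      ∑ ℓ ∈ Finset.range (2 * m), e2 ((n : ℂ) * (ℓ : ℂ) / (2 * (m : ℂ))) *
        (Nt m τ (z - (ℓ : ℂ) / (m : ℂ)) / Nt 0 τ (z - (ℓ : ℂ) / (m : ℂ)))) U := by
    apply DifferentiableOn.analyticOnNhd _ hUo
    refine DifferentiableOn.const_mul (DifferentiableOn.fun_sum fun ℓ hℓ => ?_) _
    refine DifferentiableOn.const_mul (DifferentiableOn.fun_div ?_ ?_ ?_) _
    · exact ((differentiable_Nt m hτ).comp (by fun_prop :
        Differentiable ℂ (fun z : ℂ => z - (ℓ : ℂ) / m))).differentiableOn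
    · exact ((differentiable_Nt 0 hτ).comp (by fun_prop :
        Differentiable ℂ (fun z : ℂ => z - (ℓ : ℂ) / m))).differentiableOn
    · intro z hz
      exact hz ℓ hℓ
  -- the annulus is open, and contains a point of U
  have hop : IsOpen {z : ℂ | 0 < z.im ∧ z.im < 2 * τ.im} :=
    (isOpen_lt continuous_const continuous_im).inter (isOpen_lt continuous_im continuous_const)
  have hτa : τ ∈ {z : ℂ | 0 < z.im ∧ z.im < 2 * τ.im} := ⟨hτ, by linarith⟩
  have hτU : τ ∈ U := by
    intro ℓ _ h0
    have him : (τ - (ℓ : ℂ) / (m : ℂ)).im = τ.im := by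
      have : (ℓ : ℂ) / (m : ℂ) = (((ℓ : ℝ) / (m : ℝ) : ℝ) : ℂ) := by push_cast; rfl
      rw [this, sub_im, ofReal_im, sub_zero]
    have hA := theta_mul_A (z := τ - (ℓ : ℂ) / (m : ℂ)) hτ (by rw [him]; exact hτ)
      (by rw [him]; linarith)
    rw [h0, zero_mul] at hA
    exact pow_ne_zero 3 (eta_ne hτ) (by linear_combination hA)
  have heq := hf.eqOn_of_preconnected_of_eventuallyEq hg hconn hτU (by
    filter_upwards [hop.mem_nhds hτa] with z hz
    exact annulus m hm n hτ hz.1 hz.2)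
  exact heq (hsub z hz)

theorem stmt_17 (m : ℕ) (hm : 0 < m) (n : ℤ) (hn : 0 ≤ n ∧ n < 2 * (m : ℤ)) :
    (∀ τ : ℂ, 0 < τ.im → jtheta (-1) ((m : ℂ) + 1 / 2) ((m : ℂ) + 1 / 2) τ 0 = 0) ∧
    (∀ τ z : ℂ, 0 < τ.im → (∀ a b : ℤ, (m : ℂ) * z ≠ (a : ℂ) + (b : ℂ) * τ) →
      gfun (m : ℂ) n (m : ℤ) τ * jtheta 1 (n : ℂ) (m : ℂ) τ z =
        -((-1 : ℂ) ^ m / (2 * (m : ℂ))) * dedekindEta τ ^ 3 *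
          ∑ ℓ ∈ Finset.range (2 * m), e2 ((n : ℂ) * (ℓ : ℂ) / (2 * (m : ℂ))) *
            (jtheta (-1) ((m : ℂ) + 1 / 2) ((m : ℂ) + 1 / 2) τ (z - (ℓ : ℂ) / (m : ℂ)) /
              jtheta (-1) (1 / 2) (1 / 2) τ (z - (ℓ : ℂ) / (m : ℂ)))) := by
  refine ⟨fun τ hτ => Nt_zero_at_zero m hτ, fun τ z hτ hz => ?_⟩
  have h := all_z m hm n hτ hz
  simp only [Nt, Nat.cast_zero, zero_add] at h
  exact h
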